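/- arXiv:2301.02887 — 2 statements merged into one kernel-verified Lean document; each statement's English description precedes it below -/
import Mathlib

section
/- Let n ≥ 1 and let Γ be a finite subgroup of the orthogonal group O(n). If the quotient metric space ℝⁿ/Γ is a CAT(0) space (i.e. it is a geodesic metric space in which every geodesic triangle satisfies the CAT(0) comparison inequality with respect to a Euclidean comparison triangle), then Γ is generated by reflections. -/
open scoped RealInnerProductSpace

noncomputable section

/-- Euclidean space `ℝⁿ`. -/
abbrev E (n : ℕ) : Type := EuclideanSpace ℝ (Fin n)

/-- The orthogonal group `O(n)`, realized as the group of linear isometric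
self-equivalences of `ℝⁿ`. -/
abbrev On (n : ℕ) : Type := E n ≃ₗᵢ[ℝ] E n

/-- The fixed-point subspace of a linear isometry. -/
def fixedSubmodule {K : Type} [NormedAddCommGroup K] [NormedSpace ℝ K]
    (g : K ≃ₗᵢ[ℝ] K) : Submodule ℝ K :=
  LinearMap.eqLocus (g.toLinearEquiv : K →ₗ[ℝ] K) LinearMap.id

/-- A reflection is an orthogonal transformation whose fixed-point subspace is a
hyperplane (has codimension one). -/
def IsReflection {K : Type} [NormedAddCommGroup K] [NormedSpace ℝ K]
    (g : K ≃ₗᵢ[ℝ] K) : Prop :=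
  Module.finrank ℝ (fixedSubmodule g) = Module.finrank ℝ K - 1

/-- A subgroup of `O(n)` is generated by reflections if it is the subgroup generated by
the reflections it contains. -/
def GeneratedByReflections {n : ℕ} (Γ : Subgroup (On n)) : Prop :=
  Subgroup.closure {g : On n | g ∈ Γ ∧ IsReflection g} = Γ

/-- The orbit equivalence relation of `Γ ≤ O(n)` on `ℝⁿ`. -/
def orbitSetoid {n : ℕ} (Γ : Subgroup (On n)) : Setoid (E n) where
  r x y := ∃ g ∈ Γ, g y = x
  iseqv := by
    constructor
    · exact fun x => ⟨1, Γ.one_mem, rfl⟩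
    · rintro x y ⟨g, hg, rfl⟩
      exact ⟨g⁻¹, Γ.inv_mem hg, g.symm_apply_apply y⟩
    · rintro x y z ⟨g, hg, rfl⟩ ⟨h, hh, rfl⟩
      exact ⟨g * h, Γ.mul_mem hg hh, rfl⟩

/-- The quotient metric on the orbit space `ℝⁿ/Γ`:
`d(Γx, Γy) = min_{g ∈ Γ} ‖x - g y‖`. -/
def quotDist {n : ℕ} (Γ : Subgroup (On n)) (X Y : Quotient (orbitSetoid Γ)) : ℝ :=
  ⨅ g : Γ, dist X.out ((g : On n) Y.out)

/-- `γ` is a (unit-speed) geodesic from `p` to `q` with respect to the distance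
function `d`. -/
def IsGeodesicFn {X : Type*} (d : X → X → ℝ) (p q : X) (γ : ℝ → X) : Prop :=
  γ 0 = p ∧ γ (d p q) = q ∧
    ∀ s ∈ Set.Icc (0 : ℝ) (d p q), ∀ t ∈ Set.Icc (0 : ℝ) (d p q), d (γ s) (γ t) = |s - t|

/-- `d` is a metric: symmetric, separating and satisfying the triangle inequality. -/
def IsMetricFn {X : Type*} (d : X → X → ℝ) : Prop :=
  (∀ x y, d x y = 0 ↔ x = y) ∧ (∀ x y, d x y = d y x) ∧
    ∀ x y z, d x z ≤ d x y + d y z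

/-- A distance function `d` on `X` makes `X` a CAT(0) space if it is a geodesic metric
space in which every geodesic triangle satisfies the CAT(0) comparison inequality with
respect to a Euclidean comparison triangle: for a triangle with vertices `p, q, r`,
sides issuing from `p` given by geodesics `γpq`, `γpr`, and a comparison triangle
`p', q', r'` in the Euclidean plane with the same side lengths, the distance between
points on the two sides is bounded by the Euclidean distance between the comparison
points on the corresponding sides of the comparison triangle. -/
def IsCAT0 {X : Type*} (d : X → X → ℝ) : Prop :=
  IsMetricFn d ∧ (∀ p q : X, ∃ γ : ℝ → X, IsGeodesicFn d p q γ) ∧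
    ∀ p q r : X, ∀ γpq γpr : ℝ → X, IsGeodesicFn d p q γpq → IsGeodesicFn d p r γpr →
      ∀ p' q' r' : EuclideanSpace ℝ (Fin 2),
        dist p' q' = d p q → dist p' r' = d p r → dist q' r' = d q r →
        ∀ s ∈ Set.Icc (0 : ℝ) (d p q), ∀ t ∈ Set.Icc (0 : ℝ) (d p r),
          d (γpq s) (γpr t) ≤
            dist (AffineMap.lineMap p' q' (s / d p q)) (AffineMap.lineMap p' r' (t / d p r))

/-- The unit sphere `Sⁿ⁻¹ ⊆ ℝⁿ`. -/
abbrev Sph (n : ℕ) : Type := {v : E n // ‖v‖ = 1}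

/-- The orbit equivalence relation of `Γ ≤ O(n)` on the unit sphere. -/
def sphSetoid {n : ℕ} (Γ : Subgroup (On n)) : Setoid (Sph n) where
  r x y := ∃ g ∈ Γ, g (y : E n) = (x : E n)
  iseqv := by
    constructor
    · exact fun x => ⟨1, Γ.one_mem, rfl⟩
    · rintro ⟨x, hx⟩ ⟨y, hy⟩ ⟨g, hg, h⟩
      refine ⟨g⁻¹, Γ.inv_mem hg, ?_⟩
      simp only [Subtype.coe_mk] at h ⊢
      rw [← h]
      exact g.symm_apply_apply y
    · rintro x y z ⟨g, hg, h⟩ ⟨k, hk, h'⟩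
      refine ⟨g * k, Γ.mul_mem hg hk, ?_⟩
      rw [← h, ← h']
      rfl

/-- The quotient metric on the orbit space `Sⁿ⁻¹/Γ`:
`d(Γu, Γv) = min_{g ∈ Γ} ∠(u, g v) = min_{g ∈ Γ} arccos ⟪u, g v⟫`. -/
def sphDist {n : ℕ} (Γ : Subgroup (On n)) (X Y : Quotient (sphSetoid Γ)) : ℝ :=
  ⨅ g : Γ, Real.arccos ⟪(X.out : E n), (g : On n) (Y.out : E n)⟫

lemma dense_iInter_compl_submodule {V ι : Type*} [NormedAddCommGroup V] [NormedSpace ℝ V]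
    [FiniteDimensional ℝ V] [Finite ι] (S : ι → Submodule ℝ V) (h : ∀ i, S i ≠ ⊤) :
    Dense (⋂ i, ((S i : Set V)ᶜ)) := by
  have : CompleteSpace V := FiniteDimensional.complete ℝ V
  refine dense_iInter_of_isOpen (fun i => (S i).closed_of_finiteDimensional.isOpen_compl) ?_
  intro i
  rw [← interior_eq_empty_iff_dense_compl]
  by_contra hne
  exact h i ((S i).eq_top_of_nonempty_interior' (Set.nonempty_iff_ne_empty.mpr hne))

lemma mem_fixedSubmodule {K : Type} [NormedAddCommGroup K] [NormedSpace ℝ K]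
    {g : K ≃ₗᵢ[ℝ] K} {v : K} : v ∈ fixedSubmodule g ↔ g v = v :=
  Iff.rfl

lemma fixedSubmodule_ne_top {K : Type} [NormedAddCommGroup K] [NormedSpace ℝ K]
    {g : K ≃ₗᵢ[ℝ] K} (hg : g ≠ 1) : fixedSubmodule g ≠ ⊤ := by
  intro h
  apply hg
  ext1 v
  exact mem_fixedSubmodule.mp (h ▸ Submodule.mem_top)

/-- The fixed space of an isometry that is neither the identity nor a reflection has
codimension at least two. -/
lemma fixedSubmodule_sup_span_ne_top {K : Type} [NormedAddCommGroup K] [NormedSpace ℝ K]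
    [FiniteDimensional ℝ K] {g : K ≃ₗᵢ[ℝ] K} (hg : g ≠ 1) (hr : ¬ IsReflection g) (x : K) :
    fixedSubmodule g ⊔ Submodule.span ℝ {x} ≠ ⊤ := by
  intro h
  have h1 := Submodule.finrank_lt (fixedSubmodule_ne_top hg)
  have h2 := Submodule.finrank_add_le_finrank_add_finrank
    (fixedSubmodule g) (Submodule.span ℝ {x})
  have h3 : Module.finrank ℝ (Submodule.span ℝ {x}) ≤ 1 := by
    simpa using finrank_span_le_card (R := ℝ) ({x} : Set K)
  rw [h, finrank_top] at h2
  unfold IsReflection at hr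
  omega

section Quotient

variable {n : ℕ} {Γ : Subgroup (On n)}

lemma orbit_mk_eq_iff {a b : E n} :
    (Quotient.mk (orbitSetoid Γ) a = Quotient.mk (orbitSetoid Γ) b) ↔ ∃ g ∈ Γ, g b = a :=
  Quotient.eq (r := orbitSetoid Γ)

lemma orbit_out (a : E n) : ∃ g ∈ Γ, g a = (Quotient.mk (orbitSetoid Γ) a).out :=
  orbit_mk_eq_iff.mp (Quotient.out_eq (Quotient.mk (orbitSetoid Γ) a))

lemma quotDist_mk (a b : E n) :
    quotDist Γ (Quotient.mk _ a) (Quotient.mk _ b) = ⨅ g : Γ, dist a ((g : On n) b) := by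
  obtain ⟨u, hu, hua⟩ := orbit_out (Γ := Γ) a
  obtain ⟨v, hv, hvb⟩ := orbit_out (Γ := Γ) b
  unfold quotDist
  rw [← hua, ← hvb]
  let e : Γ ≃ Γ :=
    (Equiv.mulLeft (⟨u, hu⟩⁻¹ : Γ)).trans (Equiv.mulRight (⟨v, hv⟩ : Γ))
  refine e.iInf_congr fun g => ?_
  rw [← u.dist_map a]
  congr 1
  change u (u.symm ((g : On n) (v b))) = _
  exact u.apply_symm_apply _

lemma quotDist_mk_le (a b : E n) :
    quotDist Γ (Quotient.mk _ a) (Quotient.mk _ b) ≤ dist a b := by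
  rw [quotDist_mk]
  exact ciInf_le ⟨0, by rintro _ ⟨g, rfl⟩; exact dist_nonneg⟩ (1 : Γ)

lemma quotDist_mk_eq_of_forall_le {a b : E n} (h : ∀ g ∈ Γ, dist a b ≤ dist a (g b)) :
    quotDist Γ (Quotient.mk _ a) (Quotient.mk _ b) = dist a b := by
  refine (quotDist_mk_le a b).antisymm ?_
  rw [quotDist_mk]
  exact le_ciInf fun g => h g g.2

/-- The image of a segment realizing the distance between two orbits is a geodesic. -/
lemma isGeodesicFn_lineMap (hd : IsMetricFn (quotDist Γ)) {a b : E n} (hab : a ≠ b)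
    (h : quotDist Γ (Quotient.mk _ a) (Quotient.mk _ b) = dist a b) :
    IsGeodesicFn (quotDist Γ) (Quotient.mk _ a) (Quotient.mk _ b)
      fun s => Quotient.mk _ (AffineMap.lineMap a b (s / dist a b)) := by
  have hL : 0 < dist a b := dist_pos.mpr hab
  obtain ⟨-, hsymm, htri⟩ := hd
  have hle : ∀ s t : ℝ, quotDist Γ
      (Quotient.mk _ (AffineMap.lineMap a b (s / dist a b)))
      (Quotient.mk _ (AffineMap.lineMap a b (t / dist a b))) ≤ |s - t| := by
    intro s t
    refine (quotDist_mk_le _ _).trans_eq ?_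
    rw [dist_lineMap_lineMap, Real.dist_eq, ← sub_div, abs_div, abs_of_pos hL,
      div_mul_cancel₀ _ hL.ne']
  have h0 : AffineMap.lineMap a b ((0 : ℝ) / dist a b) = a := by simp
  have h1 : AffineMap.lineMap a b (dist a b / dist a b) = b := by simp [hL.ne']
  have key : ∀ s t : ℝ, 0 ≤ s → s ≤ t → t ≤ dist a b → quotDist Γ
      (Quotient.mk _ (AffineMap.lineMap a b (s / dist a b)))
      (Quotient.mk _ (AffineMap.lineMap a b (t / dist a b))) = |s - t| := by
    intro s t hs hst ht
    refine (hle s t).antisymm ?_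
    have e1 := hle 0 s
    have e2 := hle t (dist a b)
    rw [h0, abs_of_nonpos (by linarith)] at e1
    rw [h1, abs_of_nonpos (by linarith)] at e2
    have e3 := htri (Quotient.mk _ a)
      (Quotient.mk _ (AffineMap.lineMap a b (s / dist a b))) (Quotient.mk _ b)
    have e4 := htri (Quotient.mk _ (AffineMap.lineMap a b (s / dist a b)))
      (Quotient.mk _ (AffineMap.lineMap a b (t / dist a b))) (Quotient.mk _ b)
    rw [abs_of_nonpos (by linarith)]
    linarith
  refine ⟨congrArg _ h0, by rw [h]; exact congrArg _ h1, ?_⟩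
  rw [h]
  intro s hs t ht
  rcases le_total s t with hst | hst
  · exact key s t hs.1 hst ht.2
  · rw [hsymm, abs_sub_comm]
    exact key t s ht.1 hst hs.2

/-- Geodesics with common endpoints coincide in a CAT(0) space. -/
lemma IsCAT0.geodesic_unique {X : Type*} {d : X → X → ℝ} (hcat : IsCAT0 d) {p q : X}
    {γ γ' : ℝ → X} (hγ : IsGeodesicFn d p q γ) (hγ' : IsGeodesicFn d p q γ')
    {s : ℝ} (hs : s ∈ Set.Icc 0 (d p q)) : γ s = γ' s := by
  obtain ⟨⟨hzero, hsymm, htri⟩, -, hcomp⟩ := hcat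
  have hnonneg : ∀ x y, 0 ≤ d x y := fun x y => by
    have := htri x y x
    rw [(hzero x x).mpr rfl, hsymm y x] at this
    linarith
  have hdist : dist (0 : EuclideanSpace ℝ (Fin 2)) (EuclideanSpace.single 0 (d p q)) = d p q := by
    simp [abs_of_nonneg (hnonneg p q)]
  have := hcomp p q q γ γ' hγ hγ' 0 (EuclideanSpace.single 0 (d p q))
    (EuclideanSpace.single 0 (d p q)) hdist hdist (by rw [dist_self, (hzero q q).mpr rfl])
    s hs s hs
  rw [dist_self] at this
  exact (hzero _ _).mp (this.antisymm (hnonneg _ _))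

/-- If two points of a free orbit are both nearest to `y`, the group element relating
them fixes `y`. -/
lemma apply_eq_of_dist_eq (hfin : Finite Γ) (hcat : IsCAT0 (quotDist Γ)) {x y : E n}
    (hx : ∀ g ∈ Γ, g x = x → g = 1) (hmin : ∀ g ∈ Γ, dist y x ≤ dist y (g x))
    {h : On n} (hh : h ∈ Γ) (heq : dist y (h x) = dist y x) : h y = y := by
  have hdist : dist x (h.symm y) = dist x y := by
    rw [← h.dist_map, h.apply_symm_apply, dist_comm, heq, dist_comm]
  rcases eq_or_ne x y with rfl | hxy
  · exact (dist_eq_zero.mp (by rw [heq, dist_self])).symm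
  have hL : 0 < dist x y := dist_pos.mpr hxy
  have hd : quotDist Γ (Quotient.mk _ x) (Quotient.mk _ y) = dist x y := by
    refine quotDist_mk_eq_of_forall_le fun g hg => ?_
    have := hmin g⁻¹ (Γ.inv_mem hg)
    change dist y x ≤ dist y (g.symm x) at this
    rwa [← g.dist_map y (g.symm x), g.apply_symm_apply, dist_comm, dist_comm (g y)] at this
  have hmk : (Quotient.mk (orbitSetoid Γ) (h.symm y)) = Quotient.mk _ y :=
    orbit_mk_eq_iff.mpr ⟨h⁻¹, Γ.inv_mem hh, rfl⟩
  have g1 := isGeodesicFn_lineMap hcat.1 hxy hd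
  have g2 := isGeodesicFn_lineMap hcat.1 (a := x) (b := h.symm y)
    (dist_pos.mp (hdist ▸ hL)) (by rw [hmk, hd, hdist])
  rw [hmk, hdist] at g2
  have hev : ∀ᶠ τ : ℝ in nhdsWithin 0 (Set.Ioi 0),
      ∀ k : Γ, (k : On n) x ≠ x → 2 * τ * dist x y < dist ((k : On n) x) x := by
    rw [Filter.eventually_all]
    intro k
    by_cases hk : (k : On n) x = x
    · exact Filter.Eventually.of_forall fun _ h => absurd hk h
    have hc : Filter.Tendsto (fun τ : ℝ => 2 * τ * dist x y) (nhdsWithin 0 (Set.Ioi 0))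
        (nhds 0) := by
      have : Continuous fun τ : ℝ => 2 * τ * dist x y := by fun_prop
      simpa using (this.tendsto 0).mono_left nhdsWithin_le_nhds
    filter_upwards [hc.eventually (gt_mem_nhds (dist_pos.mpr hk))] with τ hτ _ using hτ
  obtain ⟨τ, hτ, hτ0, hτ1⟩ :=
    (hev.and (Ioc_mem_nhdsGT (zero_lt_one' ℝ))).exists
  have hs : τ * dist x y ∈ Set.Icc 0 (quotDist Γ (Quotient.mk _ x) (Quotient.mk _ y)) := by
    rw [hd]
    exact ⟨by positivity, mul_le_of_le_one_left hL.le hτ1⟩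
  have huniq := hcat.geodesic_unique g1 g2 hs
  simp only [mul_div_cancel_right₀ _ hL.ne'] at huniq
  obtain ⟨k, hk, hkeq⟩ := orbit_mk_eq_iff.mp huniq
  have hk1 : k = 1 := by
    refine hx k hk ?_
    by_contra hne
    have hlt := hτ ⟨k, hk⟩ hne
    have e1 : dist (k x) (AffineMap.lineMap x y τ) = τ * dist x y := by
      rw [← hkeq, k.dist_map, dist_left_lineMap, hdist, Real.norm_of_nonneg hτ0.le]
    have e2 : dist (AffineMap.lineMap x y τ) x = τ * dist x y := by
      rw [dist_lineMap_left, Real.norm_of_nonneg hτ0.le]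
    have := dist_triangle (k x) (AffineMap.lineMap x y τ) x
    dsimp only at hlt
    linarith
  subst hk1
  change AffineMap.lineMap x (h.symm y) τ = AffineMap.lineMap x y τ at hkeq
  have : h.symm y = y := by
    simp only [AffineMap.lineMap_apply, vadd_eq_add, vsub_eq_sub, add_left_inj] at hkeq
    simpa using smul_right_injective (E n) hτ0.ne' hkeq
  rw [← this, h.apply_symm_apply, this]

lemma exists_trivial_stabilizer (hfin : Finite Γ) : ∃ x : E n, ∀ g ∈ Γ, g x = x → g = 1 := by
  obtain ⟨x, hx⟩ := (dense_iInter_compl_submodule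
    (fun g : {g : Γ // g ≠ 1} => fixedSubmodule ((g : Γ) : On n))
    fun g => fixedSubmodule_ne_top fun h => g.2 (Subtype.ext h)).nonempty
  refine ⟨x, fun g hg hgx => ?_⟩
  by_contra hne
  exact Set.mem_iInter.mp hx ⟨⟨g, hg⟩, fun h => hne (congrArg Subtype.val h)⟩ hgx

/-- The union of the closed Dirichlet cells of the points `g x`, for `g ∈ S`. -/
def dirichletUnion (Γ : Subgroup (On n)) (x : E n) (S : Set (On n)) : Set (E n) :=
  {z | ∃ g : Γ, (g : On n) ∈ S ∧ ∀ k : Γ, dist z ((g : On n) x) ≤ dist z ((k : On n) x)}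

lemma isClosed_dirichletUnion (hfin : Finite Γ) (x : E n) (S : Set (On n)) :
    IsClosed (dirichletUnion Γ x S) := by
  have : dirichletUnion Γ x S = ⋃ g : Γ, {_z | (g : On n) ∈ S} ∩
      ⋂ k : Γ, {z | dist z ((g : On n) x) ≤ dist z ((k : On n) x)} := by
    ext z
    simp [dirichletUnion]
  rw [this]
  refine isClosed_iUnion_of_finite fun g => isClosed_const.inter ?_
  exact isClosed_iInter fun k => isClosed_le (by fun_prop) (by fun_prop)

lemma mem_dirichletUnion_or_compl (hfin : Finite Γ) (x : E n) (S : Set (On n)) (z : E n) :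
    z ∈ dirichletUnion Γ x S ∪ dirichletUnion Γ x Sᶜ := by
  obtain ⟨g, hg⟩ := Finite.exists_min fun g : Γ => dist z ((g : On n) x)
  by_cases hS : (g : On n) ∈ S
  · exact Or.inl ⟨g, hS, hg⟩
  · exact Or.inr ⟨g, hS, hg⟩

/-- If `p` lies in no Dirichlet cell of a point of `R x`, then some element of `Γ` outside `R`
fixes a point of the segment from `x` to `p`. -/
lemma exists_fixed_of_segment (hfin : Finite Γ) (hcat : IsCAT0 (quotDist Γ)) {x p : E n}
    (hx : ∀ g ∈ Γ, g x = x → g = 1) (R : Subgroup (On n))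
    (hp : p ∉ dirichletUnion Γ x R) :
    ∃ f ∈ Γ, f ∉ R ∧ ∃ z ∈ segment ℝ x p, f z = z := by
  obtain ⟨z, hz, ⟨r, hrR, hr⟩, g, hgR, hg⟩ :=
    isPreconnected_closed_iff.mp (convex_segment (𝕜 := ℝ) x p).isPreconnected
      _ _ (isClosed_dirichletUnion hfin x R) (isClosed_dirichletUnion hfin x (R : Set (On n))ᶜ)
      (fun z _ => mem_dirichletUnion_or_compl hfin x R z)
      ⟨x, left_mem_segment ℝ x p, 1, R.one_mem, fun k => by
        change dist x x ≤ _
        rw [dist_self]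
        exact dist_nonneg⟩
      ⟨p, right_mem_segment ℝ x p, (mem_dirichletUnion_or_compl hfin x R p).resolve_left hp⟩
  have hsymm : ∀ v, ((r : On n)⁻¹ : On n) ((r : On n) v) = v := (r : On n).symm_apply_apply
  refine ⟨(g : On n) * (r : On n)⁻¹, Γ.mul_mem g.2 (Γ.inv_mem r.2), fun hmem => hgR ?_, z, hz, ?_⟩
  · simpa using R.mul_mem hmem hrR
  refine apply_eq_of_dist_eq hfin hcat (x := (r : On n) x) ?_ ?_
    (Γ.mul_mem g.2 (Γ.inv_mem r.2)) ?_
  · intro k hk hkr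
    have : (r : On n)⁻¹ * k * (r : On n) = 1 := by
      refine hx _ (Γ.mul_mem (Γ.mul_mem (Γ.inv_mem r.2) hk) r.2) ?_
      change ((r : On n)⁻¹ : On n) (k ((r : On n) x)) = x
      rw [hkr, hsymm]
    rw [mul_eq_one_iff_eq_inv, inv_mul_eq_iff_eq_mul, mul_inv_cancel] at this
    exact this
  · exact fun k hk => hr ⟨k * r, Γ.mul_mem hk r.2⟩
  · change dist z ((g : On n) (((r : On n)⁻¹ : On n) ((r : On n) x))) = _
    rw [hsymm]
    exact (hg r).antisymm (hr g)

end Quotient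

/-- If `Γ` is a finite subgroup of `O(n)` (`n ≥ 1`) such that the quotient
metric space `ℝⁿ/Γ` is CAT(0), then `Γ` is generated by reflections. -/
theorem stmt0 (n : ℕ) (hn : 1 ≤ n) (Γ : Subgroup (On n)) (hfin : Finite Γ)
    (hcat : IsCAT0 (quotDist Γ)) :
    GeneratedByReflections Γ := by
  set R : Subgroup (On n) := Subgroup.closure {g : On n | g ∈ Γ ∧ IsReflection g} with hRdef
  have hR : R ≤ Γ := (Subgroup.closure_le Γ).mpr fun g hg => hg.1
  refine hR.antisymm fun g hg => ?_
  by_contra hgR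
  obtain ⟨x, hx⟩ := exists_trivial_stabilizer hfin
  have hopen : IsOpen (dirichletUnion Γ x R)ᶜ :=
    (isClosed_dirichletUnion hfin x R).isOpen_compl
  have hgx : g x ∈ (dirichletUnion Γ x R)ᶜ := by
    rintro ⟨r, hrR, hr⟩
    have hle := hr ⟨g, hg⟩
    rw [dist_self] at hle
    have heq : g x = (r : On n) x := dist_le_zero.mp hle
    have : (r : On n)⁻¹ * g = 1 := by
      refine hx _ (Γ.mul_mem (Γ.inv_mem r.2) hg) ?_
      change (r : On n).symm (g x) = x
      rw [heq, (r : On n).symm_apply_apply]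
    rw [inv_mul_eq_one] at this
    exact hgR (this ▸ hrR)
  obtain ⟨p, hpA, hp⟩ := (dense_iInter_compl_submodule
    (fun f : {f : Γ // (f : On n) ∉ R} =>
      fixedSubmodule ((f : Γ) : On n) ⊔ Submodule.span ℝ {x})
    fun f => fixedSubmodule_sup_span_ne_top (g := ((f : Γ) : On n))
      (fun h => f.2 (h.symm ▸ R.one_mem))
      (fun h => f.2 (Subgroup.subset_closure ⟨f.1.2, h⟩)) x).inter_open_nonempty
    _ hopen ⟨_, hgx⟩
  obtain ⟨f, hf, hfR, z, hz, hfz⟩ := exists_fixed_of_segment hfin hcat hx R hpA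
  obtain ⟨a, b, -, hb, hab, rfl⟩ := hz
  have hb0 : b ≠ 0 := by
    rintro rfl
    obtain rfl : a = 1 := by simpa using hab
    simp only [one_smul, zero_smul, add_zero] at hfz
    exact hfR (hx f hf hfz ▸ R.one_mem)
  refine Set.mem_iInter.mp hp ⟨⟨f, hf⟩, hfR⟩ ?_
  have hbp : b • p ∈ fixedSubmodule f ⊔ Submodule.span ℝ {x} := by
    have : b • p = (a • x + b • p) + (-a) • x := by module
    rw [this]
    exact Submodule.add_mem_sup (mem_fixedSubmodule.mpr hfz)
      (Submodule.smul_mem _ _ (Submodule.mem_span_singleton_self x))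
  exact ((fixedSubmodule f ⊔ Submodule.span ℝ {x}).smul_mem_iff hb0).mp hbp

end
end

section
/- Let n ≥ 1 and let Γ be a nontrivial finite subgroup of O(n+1) acting freely on the unit sphere Sⁿ (no nontrivial element of Γ fixes a unit vector). Equip the orbit space Sⁿ/Γ with the quotient metric d(Γu, Γv) = min_{g ∈ Γ} ∠(u, g v), where ∠ denotes the angle (intrinsic spherical distance). Then Sⁿ/Γ contains a closed geodesic of length strictly less than 2π: there exist L ∈ (0, 2π) and a nonconstant L-periodic map c : ℝ → Sⁿ/Γ that is a local isometry, i.e. for every t ∈ ℝ there is ε > 0 such that d(c(s), c(s')) = |s − s'| for all s, s' ∈ (t − ε, t + ε). -/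
open scoped RealInnerProductSpace

noncomputable section

open Real Filter Topology

/-- The great circle `t ↦ cos t • u + sin t • w`. -/
def greatCircle {m : ℕ} (u w : E m) (t : ℝ) : E m := cos t • u + sin t • w

theorem inner_greatCircle {m : ℕ} {u w : E m} (hu : ‖u‖ = 1) (hw : ‖w‖ = 1)
    (huw : ⟪u, w⟫ = 0) (s t : ℝ) :
    ⟪greatCircle u w s, greatCircle u w t⟫ = cos (s - t) := by
  have hwu : ⟪w, u⟫ = 0 := by rw [real_inner_comm, huw]
  simp only [greatCircle, inner_add_left, inner_add_right, real_inner_smul_left,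
    real_inner_smul_right, real_inner_self_eq_norm_sq, hu, hw, huw, hwu, cos_sub]
  ring

theorem norm_greatCircle {m : ℕ} {u w : E m} (hu : ‖u‖ = 1) (hw : ‖w‖ = 1)
    (huw : ⟪u, w⟫ = 0) (t : ℝ) : ‖greatCircle u w t‖ = 1 := by
  have h := inner_greatCircle hu hw huw t t
  rw [real_inner_self_eq_norm_sq, sub_self, cos_zero] at h
  exact (pow_eq_one_iff_of_nonneg (norm_nonneg _) two_ne_zero).1 h

theorem continuous_greatCircle {m : ℕ} (u w : E m) : Continuous (greatCircle u w) := by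
  unfold greatCircle
  fun_prop

theorem arccos_inner_greatCircle {m : ℕ} {u w : E m} (hu : ‖u‖ = 1) (hw : ‖w‖ = 1)
    (huw : ⟪u, w⟫ = 0) {s t : ℝ} (hst : |s - t| ≤ π) :
    arccos ⟪greatCircle u w s, greatCircle u w t⟫ = |s - t| := by
  rw [inner_greatCircle hu hw huw, ← cos_abs, arccos_cos (abs_nonneg _) hst]

/-- The quotient metric may be computed with arbitrary orbit representatives. -/
theorem sphDist_mk {m : ℕ} (Γ : Subgroup (On m)) (x y : Sph m) :
    sphDist Γ (Quotient.mk (sphSetoid Γ) x) (Quotient.mk (sphSetoid Γ) y) =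
      ⨅ g : Γ, arccos ⟪(x : E m), (g : On m) (y : E m)⟫ := by
  obtain ⟨a, ha, hax⟩ : (sphSetoid Γ).r _ _ := Quotient.mk_out (s := sphSetoid Γ) x
  obtain ⟨b, hb, hby⟩ : (sphSetoid Γ).r _ _ := Quotient.mk_out (s := sphSetoid Γ) y
  unfold sphDist
  refine Equiv.iInf_congr
    ((Equiv.mulLeft (⟨a, ha⟩⁻¹ : Γ)).trans (Equiv.mulRight (⟨b, hb⟩ : Γ))) fun g => ?_
  rw [← hax, ← hby, ← a.inner_map_map]
  congr 2
  exact a.apply_symm_apply _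

/-- A linear isometry of order two without fixed unit vectors is the antipodal map. -/
theorem eq_neg_of_involutive {m : ℕ} {g : On m} (hg : ∀ v, g (g v) = v)
    (hfix : ∀ v : E m, ‖v‖ = 1 → g v ≠ v) (v : E m) : g v = -v := by
  by_contra hv
  have hne : v + g v ≠ 0 := fun h => hv (eq_neg_of_add_eq_zero_right h)
  refine hfix (‖v + g v‖⁻¹ • (v + g v)) (norm_smul_inv_norm hne) ?_
  rw [map_smul, map_add, hg, add_comm]

/-- The operator `g + g⁻¹` has a unit eigenvector. -/
theorem exists_unit_eigenvector_add_symm {m : ℕ} [Nontrivial (E m)] (g : On m) :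
    ∃ (μ : ℝ) (u : E m), ‖u‖ = 1 ∧ g u + g.symm u = μ • u := by
  let T : E m →ₗ[ℝ] E m := g.toLinearEquiv.toLinearMap + g.symm.toLinearEquiv.toLinearMap
  have hTv : ∀ v, T v = g v + g.symm v := fun v => rfl
  have hT : T.IsSymmetric := by
    intro x y
    rw [hTv, hTv, inner_add_left, inner_add_right, add_comm]
    congr 1
    · rw [← g.inner_map_map, g.apply_symm_apply]
    · rw [← g.inner_map_map x, g.apply_symm_apply]
  obtain ⟨v, hv⟩ := hT.hasEigenvalue_iSup_of_finiteDimensional.exists_hasEigenvector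
  exact ⟨_, ‖v‖⁻¹ • v, norm_smul_inv_norm hv.2,
    (map_smul T _ v).trans ((congrArg _ hv.apply_eq_smul).trans (smul_comm _ _ _))⟩

/-- An isometry without fixed unit vectors whose square is trivial or has no fixed unit vectors
translates some great circle by an angle in `(0, π]`. -/
theorem exists_greatCircle_translate {m : ℕ} (hm : 2 ≤ m) {g : On m}
    (hfix : ∀ v : E m, ‖v‖ = 1 → g v ≠ v)
    (hfix2 : g * g = 1 ∨ ∀ v : E m, ‖v‖ = 1 → (g * g) v ≠ v) :
    ∃ (u w : E m) (θ : ℝ), ‖u‖ = 1 ∧ ‖w‖ = 1 ∧ ⟪u, w⟫ = 0 ∧ 0 < θ ∧ θ ≤ π ∧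
      ∀ t, g (greatCircle u w t) = greatCircle u w (t + θ) := by
  have hrank : Module.finrank ℝ (E m) = m := finrank_euclideanSpace_fin
  have : Nontrivial (E m) := Module.nontrivial_of_finrank_pos (R := ℝ) (by omega)
  obtain ⟨μ, u, hu, hμ⟩ := exists_unit_eigenvector_add_symm g
  have huu : ⟪u, u⟫ = 1 := by rw [real_inner_self_eq_norm_sq, hu, one_pow]
  have hgu : ‖g u‖ = 1 := by rw [g.norm_map, hu]
  have hgg : g (g u) = μ • g u - u := by
    have h := congrArg g hμ
    rw [map_add, g.apply_symm_apply, map_smul] at h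
    exact eq_sub_of_add_eq h
  set c : ℝ := ⟪u, g u⟫ with hc
  have hμc : μ = 2 * c := by
    have h := congrArg (fun v => ⟪u, v⟫) hμ
    simp only [inner_add_right, real_inner_smul_right, huu, mul_one] at h
    rw [← h, ← g.inner_map_map u (g.symm u), g.apply_symm_apply, real_inner_comm u (g u)]
    ring
  have hc1 : c < 1 := by
    refine lt_of_le_of_ne ?_ fun h => hfix u hu ((inner_eq_one_iff_of_norm_eq_one hu hgu).1 h).symm
    simpa [hu, hgu] using real_inner_le_norm u (g u)
  have hcm : -1 ≤ c := by
    simpa [hu, hgu] using neg_le_of_abs_le (abs_real_inner_le_norm u (g u))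
  rcases hcm.eq_or_lt with hcm | hcm
  · have hneg : g u = -u := by
      refine ((inner_eq_one_iff_of_norm_eq_one (𝕜 := ℝ) (by rwa [norm_neg]) hgu).1 ?_).symm
      rw [inner_neg_left, ← hc, ← hcm, neg_neg]
    have hsq : g * g = 1 := hfix2.resolve_right fun h => h u hu <| by
      change g (g u) = u
      rw [hneg, map_neg, hneg, neg_neg]
    have hanti := eq_neg_of_involutive (g := g) (fun v => DFunLike.congr_fun hsq v) hfix
    obtain ⟨w, hw, huw⟩ : ∃ w : E m, ‖w‖ = 1 ∧ ⟪u, w⟫ = 0 := by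
      have hpos : 0 < Module.finrank ℝ (ℝ ∙ u)ᗮ := by
        have h1 := Submodule.finrank_add_finrank_orthogonal (ℝ ∙ u)
        have h2 := finrank_span_le_card (R := ℝ) ({u} : Set (E m))
        rw [Set.toFinset_singleton, Finset.card_singleton] at h2
        omega
      have := Module.nontrivial_of_finrank_pos hpos
      obtain ⟨w, hw⟩ := exists_norm_eq ((ℝ ∙ u)ᗮ : Submodule ℝ (E m)) zero_le_one
      exact ⟨w, hw, Submodule.mem_orthogonal_singleton_iff_inner_right.1 w.2⟩
    refine ⟨u, w, π, hu, hw, huw, pi_pos, le_rfl, fun t => ?_⟩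
    rw [hanti, greatCircle, greatCircle, cos_add_pi, sin_add_pi, neg_smul, neg_smul, neg_add]
  · have hs : 0 < 1 - c ^ 2 := by nlinarith
    have hcos : cos (arccos c) = c := cos_arccos hcm.le hc1.le
    have hsin : sin (arccos c) ≠ 0 := by
      rw [sin_arccos]
      exact (sqrt_pos.2 hs).ne'
    have hsc : sin (arccos c) ^ 2 = 1 - c ^ 2 := by rw [sin_sq, hcos]
    set θ := arccos c
    set σ := sin θ
    refine ⟨u, σ⁻¹ • (g u - c • u), θ, hu, ?_, ?_, arccos_pos.2 hc1, arccos_le_pi _, fun t => ?_⟩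
    · have h : ‖g u - c • u‖ ^ 2 = σ ^ 2 := by
        rw [norm_sub_sq_real, hgu, norm_smul, hu, real_inner_smul_right, real_inner_comm u (g u),
          ← hc, hsc, mul_one, norm_eq_abs, sq_abs]
        ring
      rw [norm_smul, norm_inv, norm_eq_abs, (sq_eq_sq_iff_abs_eq_abs _ _).1 h.symm, abs_norm,
        inv_mul_cancel₀]
      intro h0
      rw [h0] at h
      exact hsin (pow_eq_zero_iff two_ne_zero |>.1 (by linarith))
    · rw [real_inner_smul_right, inner_sub_right, real_inner_smul_right, huu, ← hc]
      ring
    · simp only [greatCircle, map_add, map_sub, map_smul, hgg, hμc, cos_add, sin_add, hcos]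
      match_scalars
      · field_simp
        ring
      · field_simp
        linear_combination sin t * hsc

/-- The projection of a great circle to the orbit space of a free finite action is a local
isometry. -/
theorem sphDist_greatCircle_locally {m : ℕ} (Γ : Subgroup (On m)) [Finite Γ]
    (hfree : ∀ g ∈ Γ, g ≠ 1 → ∀ v : E m, ‖v‖ = 1 → g v ≠ v) {u w : E m}
    (hu : ‖u‖ = 1) (hw : ‖w‖ = 1) (huw : ⟪u, w⟫ = 0) (t : ℝ) :
    ∃ ε > 0, ∀ s ∈ Set.Ioo (t - ε) (t + ε), ∀ s' ∈ Set.Ioo (t - ε) (t + ε),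
      sphDist Γ (Quotient.mk _ ⟨greatCircle u w s, norm_greatCircle hu hw huw s⟩)
        (Quotient.mk _ ⟨greatCircle u w s', norm_greatCircle hu hw huw s'⟩) = |s - s'| := by
  have hdist : Continuous fun p : ℝ × ℝ => |p.1 - p.2| := by fun_prop
  have hpi : ∀ᶠ p : ℝ × ℝ in 𝓝 (t, t), |p.1 - p.2| < π :=
    hdist.continuousAt.eventually_lt_const (by simpa using pi_pos)
  have hall : ∀ᶠ p : ℝ × ℝ in 𝓝 (t, t), ∀ g : Γ, g ≠ 1 →
      |p.1 - p.2| < arccos ⟪greatCircle u w p.1, (g : On m) (greatCircle u w p.2)⟫ := by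
    refine eventually_all.2 fun g => ?_
    by_cases hg : g = 1
    · exact Eventually.of_forall fun p h => (h hg).elim
    have hang : Continuous fun p : ℝ × ℝ =>
        arccos ⟪greatCircle u w p.1, (g : On m) (greatCircle u w p.2)⟫ :=
      continuous_arccos.comp (((continuous_greatCircle u w).comp continuous_fst).inner
        ((g : On m).continuous.comp ((continuous_greatCircle u w).comp continuous_snd)))
    refine (hdist.continuousAt.eventually_lt hang.continuousAt ?_).mono fun p hp _ => hp
    have hn := norm_greatCircle hu hw huw t
    have hgn : ‖(g : On m) (greatCircle u w t)‖ = 1 := by rw [LinearIsometryEquiv.norm_map, hn]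
    rw [sub_self, abs_zero, arccos_pos]
    refine lt_of_le_of_ne ?_ fun h => hfree g g.2 (by simpa using hg) _ hn
      ((inner_eq_one_iff_of_norm_eq_one hn hgn).1 h).symm
    exact (real_inner_le_norm _ _).trans_eq (by rw [hn, hgn, one_mul])
  obtain ⟨ε, hε, hball⟩ := Metric.eventually_nhds_iff_ball.1 (hpi.and hall)
  refine ⟨ε, hε, fun s hs s' hs' => ?_⟩
  rw [← Real.ball_eq_Ioo] at hs hs'
  obtain ⟨hlt, hg⟩ := hball (s, s') (by rw [← ball_prod_same]; exact ⟨hs, hs'⟩)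
  have hone := arccos_inner_greatCircle hu hw huw hlt.le
  rw [sphDist_mk]
  refine le_antisymm ?_ (le_ciInf fun g => ?_)
  · exact (ciInf_le (Set.finite_range _).bddBelow (1 : Γ)).trans_eq hone
  · by_cases h : g = 1
    · subst h
      exact hone.ge
    · exact (hg g h).le

/-- If a nontrivial finite subgroup `Γ ≤ O(n+1)` (`n ≥ 1`) acts freely
on the unit sphere `Sⁿ`, then the orbit space `Sⁿ/Γ` (with the quotient metric
`d(Γu, Γv) = min_{g ∈ Γ} ∠(u, g v)`) contains a closed geodesic of length `L < 2π`:
a nonconstant `L`-periodic curve `c : ℝ → Sⁿ/Γ` which is a local isometry. -/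
theorem stmt6 (n : ℕ) (hn : 1 ≤ n) (Γ : Subgroup (On (n + 1))) (hfin : Finite Γ)
    (hnt : Γ ≠ ⊥)
    (hfree : ∀ g ∈ Γ, g ≠ 1 → ∀ v : E (n + 1), ‖v‖ = 1 → g v ≠ v) :
    ∃ L : ℝ, 0 < L ∧ L < 2 * Real.pi ∧
      ∃ c : ℝ → Quotient (sphSetoid Γ),
        (∀ t, c (t + L) = c t) ∧ (∃ t s, c t ≠ c s) ∧
        ∀ t : ℝ, ∃ ε > 0, ∀ s ∈ Set.Ioo (t - ε) (t + ε), ∀ s' ∈ Set.Ioo (t - ε) (t + ε),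
          sphDist Γ (c s) (c s') = |s - s'| := by
  obtain ⟨g, hg, hg1⟩ := Γ.bot_or_exists_ne_one.resolve_left hnt
  obtain ⟨u, w, θ, hu, hw, huw, hθ, hθπ, hgt⟩ :=
    exists_greatCircle_translate (by omega) (hfree g hg hg1)
      ((eq_or_ne (g * g) 1).imp_right (hfree _ (Γ.mul_mem hg hg)))
  have hloc := sphDist_greatCircle_locally Γ hfree hu hw huw
  refine ⟨θ, hθ, by linarith [pi_pos],
    fun t => Quotient.mk _ ⟨greatCircle u w t, norm_greatCircle hu hw huw t⟩,
    fun t => Quotient.sound ⟨g, hg, hgt t⟩, ?_, hloc⟩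
  obtain ⟨ε, hε, h⟩ := hloc 0
  refine ⟨0, ε / 2, fun heq => ?_⟩
  have h0 : (0 : ℝ) ∈ Set.Ioo (0 - ε) (0 + ε) := by constructor <;> linarith
  have h1 : ε / 2 ∈ Set.Ioo (0 - ε) (0 + ε) := by constructor <;> linarith
  have h2 := h 0 h0 (ε / 2) h1
  dsimp only at heq
  rw [← heq, h 0 h0 0 h0, sub_self, abs_zero, zero_sub, abs_neg, abs_of_pos (half_pos hε)] at h2
  linarith

end
end
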